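/- For all formulas A, B, C of conditional logic, the axiom (OR), i.e. the formula ((A>C) ∧ (B>C)) → ((A∨B) > C), is valid in the class of all neighbourhood models. -/

import Mathlib

/-- Formulas of conditional logic. -/
inductive Formula : Type
  | atom : ℕ → Formula
  | bot : Formula
  | and : Formula → Formula → Formula
  | or : Formula → Formula → Formula
  | imp : Formula → Formula → Formula
  | cond : Formula → Formula → Formula

namespace Formula

/-- ¬A abbreviates A → ⊥. -/
def neg (A : Formula) : Formula := A.imp Formula.bot

/-- ⊤ abbreviates ⊥ → ⊥. -/
def top : Formula := Formula.bot.imp Formula.bot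

/-- A ↔ B abbreviates (A → B) ∧ (B → A). -/
def biimp (A B : Formula) : Formula := (A.imp B).and (B.imp A)

/-- Boolean evaluation of a formula, where atoms are evaluated via `v` and
conditional subformulas are treated as atoms evaluated via `w`. -/
def beval (v : ℕ → Bool) (w : Formula → Formula → Bool) : Formula → Bool
  | atom p => v p
  | bot => false
  | and A B => beval v w A && beval v w B
  | or A B => beval v w A || beval v w B
  | imp A B => !(beval v w A) || beval v w B
  | cond A B => w A B

/-- Classical propositional tautology (conditional subformulas treated as atoms). -/
def Tautology (F : Formula) : Prop := ∀ v w, beval v w F = true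

end Formula

open Formula

/-- Hilbert-style derivability: classical tautologies, modus ponens,
(RCEA), (RCK), (ID), (R-And), (CM), (OR), plus extra axioms from `Ax`. -/
inductive Deriv (Ax : Set Formula) : Formula → Prop
  | taut {F : Formula} : Tautology F → Deriv Ax F
  | extra {F : Formula} : F ∈ Ax → Deriv Ax F
  | mp {A B : Formula} : Deriv Ax (A.imp B) → Deriv Ax A → Deriv Ax B
  | rcea {A B C : Formula} : Deriv Ax (A.biimp B) →
      Deriv Ax ((A.cond C).biimp (B.cond C))
  | rck {A B C : Formula} : Deriv Ax (A.imp B) → Deriv Ax ((C.cond A).imp (C.cond B))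
  | id {A : Formula} : Deriv Ax (A.cond A)
  | rAnd {A B C : Formula} : Deriv Ax (((A.cond B).and (A.cond C)).imp (A.cond (B.and C)))
  | cm {A B C : Formula} : Deriv Ax (((A.cond B).and (A.cond C)).imp ((A.and B).cond C))
  | or {A B C : Formula} : Deriv Ax (((A.cond C).and (B.cond C)).imp ((A.or B).cond C))

/-- Derivability in the basic preferential conditional logic PCL. -/
def PCL : Formula → Prop := Deriv ∅

/-- Forcing of a formula at a world, for raw neighbourhood data. -/
def Force {W : Type} (N : W → Set (Set W)) (val : ℕ → Set W) : Formula → W → Prop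
  | Formula.atom p, x => x ∈ val p
  | Formula.bot, _ => False
  | Formula.and A B, x => Force N val A x ∧ Force N val B x
  | Formula.or A B, x => Force N val A x ∨ Force N val B x
  | Formula.imp A B, x => Force N val A x → Force N val B x
  | Formula.cond A B, x => ∀ α ∈ N x, (∃ y ∈ α, Force N val A y) →
      ∃ β ∈ N x, β ⊆ α ∧ (∃ y ∈ β, Force N val A y) ∧
        ∀ y ∈ β, (Force N val A y → Force N val B y)

/-- A neighbourhood model. -/
structure NbhdModel where
  W : Type
  wNonempty : Nonempty W
  N : W → Set (Set W)
  val : ℕ → Set W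
  nbhdNonempty : ∀ x : W, ∀ α ∈ N x, α.Nonempty

/-- Forcing in a neighbourhood model. -/
def NbhdModel.force (M : NbhdModel) : Formula → M.W → Prop := Force M.N M.val

/-- Validity in the class of all neighbourhood models. -/
def ValidAll (F : Formula) : Prop := ∀ (M : NbhdModel) (x : M.W), M.force F x

/-- Total reflexivity. -/
def NbhdModel.TotallyReflexive (M : NbhdModel) : Prop :=
  ∀ x : M.W, ∃ α ∈ M.N x, x ∈ α

/-- Weak centering. -/
def NbhdModel.WeaklyCentered (M : NbhdModel) : Prop :=
  ∀ x : M.W, ∀ α ∈ M.N x, x ∈ α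

/-- Centering. -/
def NbhdModel.Centered (M : NbhdModel) : Prop :=
  (∀ x : M.W, ∀ α ∈ M.N x, x ∈ α) ∧ ∀ x : M.W, {x} ∈ M.N x

/-- Uniformity. -/
def NbhdModel.Uniform (M : NbhdModel) : Prop :=
  ∀ x y : M.W, (∃ α ∈ M.N x, y ∈ α) → ⋃₀ M.N x = ⋃₀ M.N y

/-- Absoluteness. -/
def NbhdModel.Absolute (M : NbhdModel) : Prop :=
  ∀ x y : M.W, ∀ α ∈ M.N x, y ∈ α → M.N x = M.N y

/-- Conjunction of a list of formulas. -/
def conj : List Formula → Formula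
  | [] => Formula.top
  | A :: l => A.and (conj l)

/-- A set of formulas is inconsistent if some nonempty finite list of its members
has a PCL-provably contradictory conjunction. -/
def Inconsistent (S : Set Formula) : Prop :=
  ∃ L : List Formula, L ≠ [] ∧ (∀ B ∈ L, B ∈ S) ∧ PCL ((conj L).imp Formula.bot)

def Consistent (S : Set Formula) : Prop := ¬ Inconsistent S

/-- Maximal consistent set. -/
def MaxConsistent (S : Set Formula) : Prop :=
  Consistent S ∧ ∀ A ∉ S, Inconsistent (insert A S)

/-- Set of conditional consequences X^B = {C : B > C ∈ X}. -/
def condCons (X : Set Formula) (B : Formula) : Set Formula := {C | B.cond C ∈ X}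

/-- A ≤_X B iff (A ∨ B) > A ∈ X. -/
def cleq (X : Set Formula) (A B : Formula) : Prop := (A.or B).cond A ∈ X

/-- Worlds of the canonical model: pairs (X, A) with X maximal consistent, A ∈ X. -/
def CanonWorld : Type :=
  {p : Set Formula × Formula // MaxConsistent p.1 ∧ p.2 ∈ p.1}

/-- Canonical neighbourhood α^X_{(Y,B)}. -/
def sphere (X : Set Formula) (Y : CanonWorld) : Set CanonWorld :=
  {Z | condCons X Z.val.2 ⊆ Z.val.1 ∧ cleq X Z.val.2 Y.val.2 ∧ Y.val.2 ∉ Z.val.1}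
    ∪ {Y}

/-- Canonical neighbourhood function 𝒩(X,A). -/
def canonN (x : CanonWorld) : Set (Set CanonWorld) :=
  {α | ∃ Y : CanonWorld, condCons x.val.1 Y.val.2 ⊆ Y.val.1 ∧ α = sphere x.val.1 Y}

/-- Canonical valuation. -/
def canonVal (p : ℕ) : Set CanonWorld := {w | Formula.atom p ∈ w.val.1}

/-- Axiom (N). -/
def axN : Formula := (Formula.top.cond Formula.bot).neg
/-- Axiom schema (T). -/
def axT : Set Formula := {F | ∃ A : Formula, F = A.imp (A.cond Formula.bot).neg}
/-- Axiom schema (W). -/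
def axW : Set Formula := {F | ∃ A B : Formula, F = (A.cond B).imp (A.imp B)}
/-- Axiom schema (C). -/
def axC : Set Formula := {F | ∃ A B : Formula, F = (A.and B).imp (A.cond B)}
/-- Axiom schema (U1). -/
def axU1 : Set Formula :=
  {F | ∃ A : Formula,
    F = (A.neg.cond Formula.bot).imp ((A.neg.cond Formula.bot).neg.cond Formula.bot)}
/-- Axiom schema (U2). -/
def axU2 : Set Formula :=
  {F | ∃ A : Formula,
    F = (A.cond Formula.bot).neg.imp ((A.cond Formula.bot).cond Formula.bot)}

/-- Axiom (OR) is valid in the class of all neighbourhood models. -/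
theorem or_valid (A B C : Formula) :
    ValidAll (((A.cond C).and (B.cond C)).imp ((A.or B).cond C)) := by
  rintro M x ⟨hA, hB⟩ α hα ⟨y, hy, hAB⟩
  rcases hAB with h | h
  · obtain ⟨β, hβ, hβα, ⟨z, hz, hzA⟩, hAC⟩ := hA α hα ⟨y, hy, h⟩
    by_cases hex : ∃ w ∈ β, Force M.N M.val B w
    · obtain ⟨γ, hγ, hγβ, ⟨u, hu, huB⟩, hBC⟩ := hB β hβ hex
      exact ⟨γ, hγ, hγβ.trans hβα, ⟨u, hu, Or.inr huB⟩,
        fun v hv hor => hor.elim (hAC v (hγβ hv)) (hBC v hv)⟩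
    · exact ⟨β, hβ, hβα, ⟨z, hz, Or.inl hzA⟩,
        fun v hv hor => hor.elim (hAC v hv) (fun hb => absurd ⟨v, hv, hb⟩ hex)⟩
  · obtain ⟨β, hβ, hβα, ⟨z, hz, hzB⟩, hBC⟩ := hB α hα ⟨y, hy, h⟩
    by_cases hex : ∃ w ∈ β, Force M.N M.val A w
    · obtain ⟨γ, hγ, hγβ, ⟨u, hu, huA⟩, hAC⟩ := hA β hβ hex
      exact ⟨γ, hγ, hγβ.trans hβα, ⟨u, hu, Or.inl huA⟩,
        fun v hv hor => hor.elim (hAC v hv) (hBC v (hγβ hv))⟩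
    · exact ⟨β, hβ, hβα, ⟨z, hz, Or.inr hzB⟩,
        fun v hv hor => hor.elim (fun ha => absurd ⟨v, hv, ha⟩ hex) (hBC v hv)⟩
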